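/- arXiv:1712.04054 — 2 statements merged into one kernel-verified Lean document; each statement's English description precedes it below -/
import Mathlib

section
/- Let p ∈ (0,1), q = 1 − p, ε > 0, and let n ≥ 1 be a real number with n^{1/2−ε} · p/2 ≥ 1. Set H(n) = ⌈ log(n^{1/2−ε} p/2) / log(2/q) ⌉ and R_n = n^{−1/2}. Then n · (1 − R_n · (p/2)(q/2)^{H(n)})^n ≤ n · exp(−(q/2) n^{ε}). -/
open Real

/-- Rounding the exponent `log A / log b⁻¹` up to an integer costs at most one factor `b`. -/
theorem div_le_zpow_ceil_log_div_log {b A : ℝ} (hb0 : 0 < b) (hb1 : b < 1) (hA : 0 < A) :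
    b / A ≤ b ^ (⌈Real.log A / Real.log b⁻¹⌉ : ℤ) := by
  have hlog : 0 < Real.log b⁻¹ := Real.log_pos ((one_lt_inv₀ hb0).2 hb1)
  have hceil := (Int.ceil_lt_add_one (Real.log A / Real.log b⁻¹)).le
  set H : ℤ := ⌈Real.log A / Real.log b⁻¹⌉
  rw [← Real.log_le_log_iff (by positivity) (by positivity), Real.log_zpow,
    Real.log_div hb0.ne' hA.ne']
  have hmul := mul_le_mul_of_nonneg_right hceil hlog.le
  rw [add_mul, div_mul_cancel₀ _ hlog.ne', Real.log_inv] at hmul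
  linarith

/-- The bound `1 - x ≤ exp (-x)` raised to a real power. -/
theorem one_sub_rpow_le_exp {x n : ℝ} (hx : x ≤ 1) (hn : 0 ≤ n) :
    (1 - x) ^ n ≤ Real.exp (-x * n) := by
  rw [Real.exp_mul]
  exact Real.rpow_le_rpow (sub_nonneg.2 hx) (Real.one_sub_le_exp_neg x) hn

/-- Paper's Lemma 6: with radio range `R_n = n^{−1/2}` and
`H(n) = ⌈log(n^{1/2−ε} p/2)/log(2/q)⌉`, the probability that some inter-node
gap on a street of level `H(n)` exceeds `R_n` is bounded by
`n (1 − R_n (p/2)(q/2)^{H(n)})^n ≤ n exp(−(q/2) n^ε)`. -/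
theorem gap_probability_radio_range (p q ε n : ℝ) (hp0 : 0 < p) (hp1 : p < 1)
    (hq : q = 1 - p) (hε : 0 < ε) (hn1 : 1 ≤ n)
    (hn : 1 ≤ n ^ (1 / 2 - ε) * p / 2) :
    n * (1 - n ^ (-(1 / 2) : ℝ) * ((p / 2) *
        (q / 2) ^ (⌈Real.log (n ^ (1 / 2 - ε) * p / 2) / Real.log (2 / q)⌉ : ℤ))) ^ n
      ≤ n * Real.exp (-(q / 2) * n ^ ε) := by
  have hn0 : 0 < n := by linarith
  have hb0 : 0 < q / 2 := by linarith
  have hb1 : q / 2 < 1 := by linarith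
  have hA : 0 < n ^ (1 / 2 - ε) * p / 2 := by linarith
  have hlow := div_le_zpow_ceil_log_div_log hb0 hb1 hA
  have hH : 0 ≤ ⌈Real.log (n ^ (1 / 2 - ε) * p / 2) / Real.log (q / 2)⁻¹⌉ :=
    Int.ceil_nonneg (div_nonneg (Real.log_nonneg hn)
      (Real.log_pos ((one_lt_inv₀ hb0).2 hb1)).le)
  rw [← inv_div q 2]
  set H : ℤ := ⌈Real.log (n ^ (1 / 2 - ε) * p / 2) / Real.log (q / 2)⁻¹⌉
  have hpow_le : (q / 2) ^ H ≤ 1 := zpow_le_one₀ hb0 hb1.le hH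
  have hR : n ^ (-(1 / 2) : ℝ) ≤ 1 := Real.rpow_le_one_of_one_le_of_nonpos hn1 (by norm_num)
  have hx : n ^ (-(1 / 2) : ℝ) * ((p / 2) * (q / 2) ^ H) ≤ 1 :=
    mul_le_one₀ hR (by positivity) (mul_le_one₀ (by linarith) (by positivity) hpow_le)
  refine mul_le_mul_of_nonneg_left ((one_sub_rpow_le_exp hx hn0.le).trans ?_) hn0.le
  rw [Real.exp_le_exp, neg_mul, neg_mul, neg_le_neg_iff]
  have hsplit : n ^ ε * n ^ (1 / 2 - ε) = n ^ (-(1 / 2) : ℝ) * n := by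
    nth_rewrite 4 [← Real.rpow_one n]
    rw [← Real.rpow_add hn0, ← Real.rpow_add hn0]
    norm_num
  calc q / 2 * n ^ ε
      = n ^ (-(1 / 2) : ℝ) * ((p / 2) * (q / 2 / (n ^ (1 / 2 - ε) * p / 2))) * n := by
        have hN : 0 < n ^ (1 / 2 - ε) := Real.rpow_pos_of_pos hn0 _
        generalize n ^ (1 / 2 - ε) = N at hsplit hN ⊢
        field_simp
        linear_combination q * hsplit
    _ ≤ n ^ (-(1 / 2) : ℝ) * ((p / 2) * (q / 2) ^ H) * n := by gcongr
end

section
/- Let a > 1 and c ∈ (0,1) satisfy log a < log(1/c), and set δ = log a / log(1/c) ∈ (0,1). Then for every x ≥ 0 the series f(x) = Σ_{l=0}^∞ a^l (1 − e^{−x c^l}) converges, and f(x) = Θ(x^δ) as x → ∞: there exist constants 0 < C₁ ≤ C₂ and x₀ > 0 such that C₁ x^δ ≤ f(x) ≤ C₂ x^δ for all x ≥ x₀. -/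
open Real

/-- Each term of the harmonic sum is dominated by a geometric term. -/
lemma harmonic_term_le {a c : ℝ} (ha : 0 ≤ a) (x : ℝ) (l : ℕ) :
    a ^ l * (1 - exp (-(x * c ^ l))) ≤ x * (a * c) ^ l := by
  have h := add_one_le_exp (-(x * c ^ l))
  calc a ^ l * (1 - exp (-(x * c ^ l))) ≤ a ^ l * (x * c ^ l) := by gcongr; linarith
    _ = x * (a * c) ^ l := by rw [mul_pow]; ring

lemma harmonic_term_nonneg {a c x : ℝ} (ha : 0 ≤ a) (hc : 0 ≤ c) (hx : 0 ≤ x) (l : ℕ) :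
    0 ≤ a ^ l * (1 - exp (-(x * c ^ l))) := by
  have h : exp (-(x * c ^ l)) ≤ 1 := exp_le_one_iff.2 (neg_nonpos.2 (by positivity))
  exact mul_nonneg (by positivity) (by linarith)

lemma summable_harmonic {a c x : ℝ} (ha : 0 ≤ a) (hc : 0 ≤ c) (hac : a * c < 1) (hx : 0 ≤ x) :
    Summable (fun l : ℕ => a ^ l * (1 - exp (-(x * c ^ l)))) :=
  .of_nonneg_of_le (harmonic_term_nonneg ha hc hx) (harmonic_term_le ha x)
    ((summable_geometric_of_lt_one (by positivity) hac).mul_left x)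

/-- Lower bound by a single term whose exponent is at least one. -/
lemma le_tsum_harmonic {a c x : ℝ} (ha : 0 ≤ a) (hc : 0 ≤ c) (hac : a * c < 1) (hx : 0 ≤ x)
    {n : ℕ} (hn : 1 ≤ x * c ^ n) :
    a ^ n * (1 - exp (-1)) ≤ ∑' l : ℕ, a ^ l * (1 - exp (-(x * c ^ l))) := by
  calc a ^ n * (1 - exp (-1)) ≤ a ^ n * (1 - exp (-(x * c ^ n))) := by gcongr
    _ ≤ _ := (summable_harmonic ha hc hac hx).le_tsum n
      fun l _ => harmonic_term_nonneg ha hc hx l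

/-- Upper bound obtained by splitting the sum at an index where the exponent is at most one. -/
lemma tsum_harmonic_le {a c x : ℝ} (ha : 1 < a) (hc : 0 ≤ c) (hac : a * c < 1) (hx : 0 ≤ x)
    {m : ℕ} (hm : x * c ^ m ≤ 1) :
    ∑' l : ℕ, a ^ l * (1 - exp (-(x * c ^ l))) ≤ a ^ m * (1 / (a - 1) + 1 / (1 - a * c)) := by
  have ha0 : 0 ≤ a := by linarith
  have hs := summable_harmonic ha0 hc hac hx
  have hgeom := summable_geometric_of_lt_one (mul_nonneg ha0 hc) hac
  rw [← hs.sum_add_tsum_nat_add m, mul_add]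
  gcongr ?_ + ?_
  · calc ∑ l ∈ Finset.range m, a ^ l * (1 - exp (-(x * c ^ l)))
        ≤ ∑ l ∈ Finset.range m, a ^ l := by
          refine Finset.sum_le_sum fun l _ => mul_le_of_le_one_right (by positivity) ?_
          linarith [exp_pos (-(x * c ^ l))]
      _ = (a ^ m - 1) / (a - 1) := geom_sum_eq ha.ne' m
      _ ≤ a ^ m * (1 / (a - 1)) := by
          rw [mul_one_div]
          exact div_le_div_of_nonneg_right (by linarith) (by linarith)
  · calc ∑' l : ℕ, a ^ (l + m) * (1 - exp (-(x * c ^ (l + m))))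
        ≤ ∑' l : ℕ, a ^ m * (a * c) ^ l := by
          refine ((summable_nat_add_iff m).2 hs).tsum_le_tsum (fun l => ?_) (hgeom.mul_left _)
          calc a ^ (l + m) * (1 - exp (-(x * c ^ (l + m)))) ≤ x * (a * c) ^ (l + m) :=
                harmonic_term_le ha0 x (l + m)
            _ = (x * c ^ m) * (a ^ m * (a * c) ^ l) := by rw [pow_add, mul_pow a c m]; ring
            _ ≤ a ^ m * (a * c) ^ l := mul_le_of_le_one_left (by positivity) hm
      _ = a ^ m * (1 / (1 - a * c)) := by
          rw [tsum_mul_left, tsum_geometric_of_lt_one (mul_nonneg ha0 hc) hac, one_div]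

lemma inv_pow_rpow_log_div_log {a c : ℝ} (ha : 0 < a) (hc0 : 0 < c) (hc1 : c < 1) (n : ℕ) :
    ((c ^ n)⁻¹) ^ (log a / log (1 / c)) = a ^ n := by
  have h1c : 1 < 1 / c := one_lt_one_div hc0 hc1
  have hbase : (1 / c) ^ (log a / log (1 / c)) = a := by
    rw [rpow_def_of_pos (by positivity), mul_div_cancel₀ _ (log_pos h1c).ne', exp_log ha]
  rw [← inv_pow, ← one_div, ← rpow_pow_comm (by positivity), hbase]

/-- Harmonic-sum estimate underlying the paper's Lemmas 1 and 7: for `a > 1`,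
`c ∈ (0,1)` with `log a < log(1/c)` and `δ = log a / log(1/c) ∈ (0,1)`, the
series `f(x) = Σ_{l=0}^∞ a^l (1 − e^{−x c^l})` converges for every `x ≥ 0`
and `f(x) = Θ(x^δ)` as `x → ∞`. -/
theorem harmonic_sum_estimate (a c : ℝ) (ha : 1 < a) (hc0 : 0 < c) (hc1 : c < 1)
    (hlog : Real.log a < Real.log (1 / c)) :
    (∀ x : ℝ, 0 ≤ x →
      Summable (fun l : ℕ => a ^ l * (1 - Real.exp (-(x * c ^ l))))) ∧
    ∃ C₁ C₂ x₀ : ℝ, 0 < C₁ ∧ C₁ ≤ C₂ ∧ 0 < x₀ ∧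
      ∀ x : ℝ, x₀ ≤ x →
        C₁ * x ^ (Real.log a / Real.log (1 / c)) ≤
            (∑' l : ℕ, a ^ l * (1 - Real.exp (-(x * c ^ l)))) ∧
          (∑' l : ℕ, a ^ l * (1 - Real.exp (-(x * c ^ l)))) ≤
            C₂ * x ^ (Real.log a / Real.log (1 / c)) := by
  have ha0 : 0 < a := by linarith
  have h1c : 1 < 1 / c := one_lt_one_div hc0 hc1
  have hac : a * c < 1 := (lt_div_iff₀ hc0).1 ((log_lt_log_iff ha0 (by positivity)).1 hlog)
  set δ := log a / log (1 / c)
  have hδ0 : 0 ≤ δ := (div_pos (log_pos ha) (log_pos h1c)).le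
  have he : 0 < 1 - exp (-1) := sub_pos.2 (exp_lt_one_iff.2 (by norm_num))
  set K := 1 / (a - 1) + 1 / (1 - a * c)
  have hK0 : 0 < K :=
    add_pos (one_div_pos.2 (by linarith)) (one_div_pos.2 (by linarith))
  have bounds : ∀ x : ℝ, 1 ≤ x →
      (1 - exp (-1)) / a * x ^ δ ≤ (∑' l : ℕ, a ^ l * (1 - exp (-(x * c ^ l)))) ∧
        (∑' l : ℕ, a ^ l * (1 - exp (-(x * c ^ l)))) ≤ a * K * x ^ δ := by
    intro x hx
    have hx0 : 0 < x := by linarith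
    obtain ⟨n, hlt, hle⟩ :=
      exists_nat_pow_near_of_lt_one (inv_pos.2 hx0) (inv_le_one_of_one_le₀ hx) hc0 hc1
    have hupper : x ^ δ ≤ a ^ (n + 1) := by
      rw [← inv_pow_rpow_log_div_log ha0 hc0 hc1]
      exact rpow_le_rpow hx0.le ((le_inv_comm₀ (by positivity) hx0).1 hlt.le) hδ0
    have hlower : a ^ n ≤ x ^ δ := by
      rw [← inv_pow_rpow_log_div_log ha0 hc0 hc1]
      exact rpow_le_rpow (by positivity) (inv_le_of_inv_le₀ hx0 hle) hδ0
    constructor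
    · calc (1 - exp (-1)) / a * x ^ δ ≤ (1 - exp (-1)) / a * a ^ (n + 1) := by gcongr
        _ = a ^ n * (1 - exp (-1)) := by rw [pow_succ]; field_simp
        _ ≤ _ := le_tsum_harmonic ha0.le hc0.le hac hx0.le ((inv_le_iff_one_le_mul₀' hx0).1 hle)
    · calc _ ≤ a ^ (n + 1) * K :=
            tsum_harmonic_le ha hc0.le hac hx0.le ((le_inv_mul_iff₀ hx0).1 (by simpa using hlt.le))
        _ = a * K * a ^ n := by ring
        _ ≤ a * K * x ^ δ := by gcongr
  refine ⟨fun x hx => summable_harmonic ha0.le hc0.le hac hx,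
    (1 - exp (-1)) / a, a * K, 1, by positivity, ?_, one_pos, bounds⟩
  simpa using (bounds 1 le_rfl).1.trans (bounds 1 le_rfl).2
end
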